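/- Let α ≥ 1 be an integer and let t ∈ R be a homogeneous polynomial of degree α whose coefficient of the monomial y^α is nonzero. Then the element −1/(x^2·y^{αp+1}) + t/(x^{α+1}·y^{αp+2}) − t^p/(x^{αp+1}·y^{αp+2}) of R_{xy} does not lie in the submodule N; equivalently, its class in E = R_{xy}/N is nonzero. In other words, the equation −1/(x^2·y^{αp+1}) + t/(x^{α+1}·y^{αp+2}) = t^p/(x^{αp+1}·y^{αp+2}) fails in E. -/

import Mathlib

open MvPolynomial TensorProduct

noncomputable section

/-- `R = k[x,y]`, the polynomial ring in two variables with its standard grading. -/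
abbrev R (k : Type) [Field k] : Type := MvPolynomial (Fin 2) k

/-- The variable `x`. -/
abbrev Xx (k : Type) [Field k] : R k := X 0
/-- The variable `y`. -/
abbrev Xy (k : Type) [Field k] : R k := X 1

/-- `R^{(1)}`: the ring `R` viewed as an `R`-algebra via the Frobenius `r ↦ r^p`. -/
def R1 (p : ℕ) (k : Type) [Field k] : Type := MvPolynomial (Fin 2) k

instance (p : ℕ) (k : Type) [Field k] : CommRing (R1 p k) :=
  inferInstanceAs (CommRing (R k))

instance (p : ℕ) (k : Type) [Field k] [Fact p.Prime] [CharP k p] :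
    Algebra (R k) (R1 p k) :=
  (frobenius (R k) p).toAlgebra

/-- The Frobenius base change `F(M) = R^{(1)} ⊗_R M` of an `R`-module `M`; in it one has
`a ⊗ r·m = (r^p·a) ⊗ m`. -/
def F (p : ℕ) (k : Type) [Field k] [Fact p.Prime] [CharP k p]
    (M : Type) [AddCommGroup M] [Module (R k) M] : Type :=
  TensorProduct (R k) (R1 p k) M

section Finst
variable (p : ℕ) (k : Type) [Field k] [Fact p.Prime] [CharP k p]
variable (M : Type) [AddCommGroup M] [Module (R k) M]

instance : AddCommGroup (F p k M) :=
  inferInstanceAs (AddCommGroup (TensorProduct (R k) (R1 p k) M))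

/-- `F(M)` is an `R`-module via multiplication on the factor `R^{(1)}`:
`r·(a ⊗ m) = (r·a) ⊗ m`. -/
instance : Module (R k) (F p k M) :=
  inferInstanceAs (Module (R1 p k) (TensorProduct (R k) (R1 p k) M))

end Finst

/-- The element `a ⊗ m` of `F(M)`, for `a ∈ R^{(1)} = R` and `m ∈ M`. -/
def tmul (p : ℕ) (k : Type) [Field k] [Fact p.Prime] [CharP k p]
    {M : Type} [AddCommGroup M] [Module (R k) M] (a : R k) (m : M) : F p k M :=
  show TensorProduct (R k) (R1 p k) M from (show R1 p k from a) ⊗ₜ[R k] m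

/-- The base change `F(φ) : F(A) → F(B)` of an `R`-linear map `φ : A → B`. -/
def Fmap (p : ℕ) (k : Type) [Field k] [Fact p.Prime] [CharP k p]
    {A B : Type} [AddCommGroup A] [Module (R k) A] [AddCommGroup B] [Module (R k) B]
    (φ : A →ₗ[R k] B) : F p k A →ₗ[R k] F p k B :=
  show TensorProduct (R k) (R1 p k) A →ₗ[R1 p k] TensorProduct (R k) (R1 p k) B from
    LinearMap.baseChange (R1 p k) φ

/-- `R_x`, the localization of `R` at the powers of `x`. -/
abbrev Rx (k : Type) [Field k] : Type := Localization.Away (Xx k)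

/-- `R_{xy}`, the localization of `R` at the powers of `xy`. -/
abbrev Rxy (k : Type) [Field k] : Type := Localization.Away (Xx k * Xy k)

/-- The `R`-submodule `N` of `R_{xy}` generated by the images of the canonical
localization maps `R_x → R_{xy}` and `R_y → R_{xy}`: the image of `R_x` consists of the
elements `f/x^n = (f·y^n)/(xy)^n`, and the image of `R_y` of the elements
`f/y^n = (f·x^n)/(xy)^n`. -/
def NN (k : Type) [Field k] : Submodule (R k) (Rxy k) :=
  Submodule.span (R k)
    ({z | ∃ (f : R k) (n : ℕ),
        z = Localization.mk (f * Xy k ^ n) ⟨(Xx k * Xy k) ^ n, pow_mem (Submonoid.mem_powers _) n⟩} ∪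
     {z | ∃ (f : R k) (n : ℕ),
        z = Localization.mk (f * Xx k ^ n) ⟨(Xx k * Xy k) ^ n, pow_mem (Submonoid.mem_powers _) n⟩})

/-- `E = R_{xy}/N`, a model for `H^2_{(x,y)}(R)`, the graded injective hull of `k`. -/
abbrev E (k : Type) [Field k] : Type := Rxy k ⧸ NN k

/-- The fraction `f/(x^a·y^b) = (f·x^b·y^a)/(xy)^{a+b}` as an element of `R_{xy}`. -/
def frac (k : Type) [Field k] (f : R k) (a b : ℕ) : Rxy k :=
  Localization.mk (f * Xx k ^ b * Xy k ^ a)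
    ⟨(Xx k * Xy k) ^ (a + b), pow_mem (Submonoid.mem_powers _) (a + b)⟩

/-- The degree-`d` homogeneous elements of `R`, indexed by `d : ℤ` (for `d < 0` only `0`). -/
def RComp (k : Type) [Field k] (d : ℤ) : Set (R k) :=
  {f | ∃ i : ℕ, (i : ℤ) = d ∧ f.IsHomogeneous i} ∪ {0}

/-- The degree-`d` homogeneous elements of `R_x`: fractions `f/x^n` with `f`
homogeneous of degree `e` and `e - n = d`. -/
def RxComp (k : Type) [Field k] (d : ℤ) : Set (Rx k) :=
  {m | ∃ (f : R k) (e n : ℕ), f.IsHomogeneous e ∧ (e : ℤ) - n = d ∧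
    m = Localization.mk f ⟨Xx k ^ n, pow_mem (Submonoid.mem_powers _) n⟩}

/-- The degree-`d` homogeneous elements of `R_{xy}`: fractions `f/(xy)^n` with `f`
homogeneous of degree `e` and `e - 2n = d`. -/
def RxyComp (k : Type) [Field k] (d : ℤ) : Set (Rxy k) :=
  {m | ∃ (f : R k) (e n : ℕ), f.IsHomogeneous e ∧ (e : ℤ) - 2 * n = d ∧
    m = Localization.mk f ⟨(Xx k * Xy k) ^ n, pow_mem (Submonoid.mem_powers _) n⟩}

/-- The degree-`d` homogeneous elements of `E`: classes of degree-`d` homogeneous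
elements of `R_{xy}`. -/
def EComp (k : Type) [Field k] (d : ℤ) : Set (E k) :=
  {e | ∃ m ∈ RxyComp k d, Submodule.Quotient.mk m = e}

/-- The degree-`d` homogeneous elements of `F(M)`: sums of elements `a ⊗ m` with `a`
homogeneous of degree `i`, `m` homogeneous of degree `j` and `i + p·j = d`. -/
def FComp (p : ℕ) (k : Type) [Field k] [Fact p.Prime] [CharP k p]
    {M : Type} [AddCommGroup M] [Module (R k) M] (HM : ℤ → Set M) (d : ℤ) :
    Set (F p k M) :=
  (AddSubgroup.closure {z | ∃ (a : R k) (m : M) (i : ℕ) (j : ℤ),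
    a.IsHomogeneous i ∧ m ∈ HM j ∧ (i : ℤ) + p * j = d ∧ z = tmul p k a m} :
      AddSubgroup (F p k M))

/-- An `R`-linear map between graded modules is homogeneous of degree `d` if it raises
degrees of homogeneous elements by `d`. -/
def IsDegMap (k : Type) [Field k] {A B : Type} [AddCommGroup A] [Module (R k) A]
    [AddCommGroup B] [Module (R k) B] (HA : ℤ → Set A) (HB : ℤ → Set B)
    (φ : A →ₗ[R k] B) (d : ℤ) : Prop :=
  ∀ (e : ℤ) (a : A), a ∈ HA e → φ a ∈ HB (e + d)

/-- `*Hom_R(A, B)`: the `R`-submodule of `Hom_R(A, B)` consisting of (sums of)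
homogeneous maps; its degree-`d` component consists of the degree-`d` maps. -/
def starHom (k : Type) [Field k] {A B : Type} [AddCommGroup A] [Module (R k) A]
    [AddCommGroup B] [Module (R k) B] (HA : ℤ → Set A) (HB : ℤ → Set B) :
    Submodule (R k) (A →ₗ[R k] B) :=
  Submodule.span (R k) {φ | ∃ d : ℤ, IsDegMap k HA HB φ d}

/-- The degree-`d` component of `*Hom_R(A, B)`. -/
def starHomComp (k : Type) [Field k] {A B : Type} [AddCommGroup A] [Module (R k) A]
    [AddCommGroup B] [Module (R k) B] (HA : ℤ → Set A) (HB : ℤ → Set B) (d : ℤ) :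
    Set ↥(starHom k HA HB) :=
  {φ | IsDegMap k HA HB φ.1 d}

/-- The componentwise grading on a direct sum `A ⊕ B`. -/
def ProdComp {A B : Type} (HA : ℤ → Set A) (HB : ℤ → Set B) (d : ℤ) : Set (A × B) :=
  {z | z.1 ∈ HA d ∧ z.2 ∈ HB d}

/-- An element of `N` becomes a polynomial in the ideal `(x^n, y^n)` after multiplication by
`(xy)^n`, for some `n`. -/
theorem exists_pow_mul_eq_of_mem_NN {k : Type} [Field k] {z : Rxy k} (hz : z ∈ NN k) :
    ∃ (n : ℕ) (f h : R k), algebraMap (R k) (Rxy k) ((Xx k * Xy k) ^ n) * z =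
      algebraMap (R k) (Rxy k) (f * Xx k ^ n + h * Xy k ^ n) := by
  induction hz using Submodule.span_induction with
  | mem z hz =>
    rcases hz with ⟨f, n, rfl⟩ | ⟨f, n, rfl⟩
    · refine ⟨n, 0, f, ?_⟩
      rw [zero_mul, zero_add, mul_comm, Localization.mk_eq_mk']
      exact IsLocalization.mk'_spec (Rxy k) _ _
    · refine ⟨n, f, 0, ?_⟩
      rw [zero_mul, add_zero, mul_comm, Localization.mk_eq_mk']
      exact IsLocalization.mk'_spec (Rxy k) _ _
  | zero => exact ⟨0, 0, 0, by simp⟩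
  | add z w _ _ hz hw =>
    obtain ⟨n, f, h, hz⟩ := hz
    obtain ⟨m, f', h', hw⟩ := hw
    refine ⟨n + m, f * Xy k ^ m + f' * Xy k ^ n, h * Xx k ^ m + h' * Xx k ^ n,
      ?_⟩
    simp only [map_add, map_mul, map_pow] at hz hw ⊢
    linear_combination
      (algebraMap (R k) (Rxy k) (Xx k) * algebraMap (R k) (Rxy k) (Xy k)) ^ m * hz +
      (algebraMap (R k) (Rxy k) (Xx k) * algebraMap (R k) (Rxy k) (Xy k)) ^ n * hw
  | smul r z _ hz =>
    obtain ⟨n, f, h, hz⟩ := hz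
    refine ⟨n, r * f, r * h, ?_⟩
    rw [Algebra.smul_def]
    simp only [map_add, map_mul, map_pow] at hz ⊢
    linear_combination algebraMap (R k) (Rxy k) r * hz

theorem algebraMap_mul_frac {k : Type} [Field k] (f : R k) (a b : ℕ) :
    algebraMap (R k) (Rxy k) (Xx k ^ a * Xy k ^ b) * frac k f a b =
      algebraMap (R k) (Rxy k) f := by
  have hu : IsUnit (algebraMap (R k) (Rxy k) (Xx k ^ b * Xy k ^ a)) := by
    have hxy := IsLocalization.Away.algebraMap_isUnit (S := Rxy k) (Xx k * Xy k)
    rw [map_mul, IsUnit.mul_iff] at hxy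
    simpa only [map_mul, map_pow] using (hxy.1.pow b).mul (hxy.2.pow a)
  have h : frac k f a b * algebraMap (R k) (Rxy k) ((Xx k * Xy k) ^ (a + b)) =
      algebraMap (R k) (Rxy k) (f * Xx k ^ b * Xy k ^ a) := by
    rw [frac, Localization.mk_eq_mk']
    exact IsLocalization.mk'_spec (Rxy k) _ _
  apply hu.mul_left_cancel
  simp only [map_mul, map_pow] at h ⊢
  linear_combination h

/-- A numerator of an element of `N` with denominator `x^a y^b` has no monomials outside the ideal
`(x^a, y^b)`. -/
theorem coeff_eq_zero_of_mem_NN {k : Type} [Field k] {z : Rxy k} (hz : z ∈ NN k) {g : R k}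
    {a b : ℕ} (hg : algebraMap (R k) (Rxy k) (Xx k ^ a * Xy k ^ b) * z =
      algebraMap (R k) (Rxy k) g) {m : Fin 2 →₀ ℕ} (ha : m 0 < a) (hb : m 1 < b) :
    coeff m g = 0 := by
  obtain ⟨n, f, h, hz⟩ := exists_pow_mul_eq_of_mem_NN hz
  have hinj : Function.Injective (algebraMap (R k) (Rxy k)) :=
    IsLocalization.injective _ (powers_le_nonZeroDivisors_of_noZeroDivisors
      (mul_ne_zero (X_ne_zero 0) (X_ne_zero 1)))
  have hpoly : monomial (Finsupp.single 0 n + Finsupp.single 1 n) 1 * g =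
      monomial (Finsupp.single 0 (a + n) + Finsupp.single 1 b) 1 * f +
        monomial (Finsupp.single 0 a + Finsupp.single 1 (b + n)) 1 * h := by
    have hmon (i j : ℕ) : monomial (Finsupp.single 0 i + Finsupp.single 1 j) 1 =
        Xx k ^ i * Xy k ^ j := by
      simp [X_pow_eq_monomial, monomial_mul]
    apply hinj
    simp only [hmon, map_add, map_mul, map_pow] at hz hg ⊢
    linear_combination algebraMap (R k) (Rxy k) (Xx k) ^ a *
      algebraMap (R k) (Rxy k) (Xy k) ^ b * hz -
      (algebraMap (R k) (Rxy k) (Xx k) * algebraMap (R k) (Rxy k) (Xy k)) ^ n * hg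
  have hc := congrArg (coeff (Finsupp.single 0 n + Finsupp.single 1 n + m)) hpoly
  rw [coeff_monomial_mul, one_mul, coeff_add, coeff_monomial_mul', coeff_monomial_mul', if_neg,
    if_neg, add_zero] at hc
  · exact hc
  · intro hle
    have := hle 1
    simp at this
    omega
  · intro hle
    have := hle 0
    simp at this
    omega

theorem coeff_smul_pow_char {k σ : Type*} [CommRing k] (p : ℕ) [Fact p.Prime] [CharP k p]
    (f : MvPolynomial σ k) (m : σ →₀ ℕ) : coeff (p • m) (f ^ p) = coeff m f ^ p := by
  rw [← map_frobenius_expand p, coeff_map, coeff_expand_smul _ (Fact.out : p.Prime).ne_zero,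
    frobenius_def]

theorem stmt5 (p : ℕ) [Fact p.Prime] (k : Type) [Field k] [CharP k p]
    (α : ℕ) (hα : 1 ≤ α) (t : R k) (ht : t.IsHomogeneous α)
    (hty : coeff (Finsupp.single (1 : Fin 2) α) t ≠ 0) :
    (Submodule.Quotient.mk
        (- frac k 1 2 (α * p + 1) + frac k t (α + 1) (α * p + 2)
          - frac k (t ^ p) (α * p + 1) (α * p + 2)) : E k) ≠ 0 := by
  have hp : 2 ≤ p := (Fact.out : p.Prime).two_le
  have hαp : α * 2 ≤ α * p := Nat.mul_le_mul_left α hp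
  rw [Ne, Submodule.Quotient.mk_eq_zero]
  intro hz
  obtain ⟨c, hc⟩ : ∃ c, α * p = α + c + 1 := ⟨α * p - α - 1, by omega⟩
  obtain ⟨d, hd⟩ : ∃ d, α * p = d + 1 + 1 := ⟨α * p - 2, by omega⟩
  have h0 : coeff (p • Finsupp.single (1 : Fin 2) α)
      (- (Xx k ^ (d + 1) * Xy k) + t * Xx k ^ (c + 1) - t ^ p) = 0 := by
    refine coeff_eq_zero_of_mem_NN hz (a := α * p + 1) (b := α * p + 2) ?_ (by simp)
      (by simp [mul_comm])
    have h1 := algebraMap_mul_frac (1 : R k) 2 (α * p + 1)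
    have h2 := algebraMap_mul_frac t (α + 1) (α * p + 2)
    have h3 := algebraMap_mul_frac (t ^ p) (α * p + 1) (α * p + 2)
    have e1 : Xx k ^ (α * p + 1) = Xx k ^ (d + 1) * Xx k ^ 2 := by rw [hd]; ring
    have e2 : Xx k ^ (α * p + 1) = Xx k ^ (c + 1) * Xx k ^ (α + 1) := by rw [hc]; ring
    replace e1 := congrArg (algebraMap (R k) (Rxy k)) e1
    replace e2 := congrArg (algebraMap (R k) (Rxy k)) e2
    simp only [map_add, map_sub, map_neg, map_mul, map_pow, map_one] at h1 h2 h3 e1 e2 ⊢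
    generalize frac k 1 2 (α * p + 1) = u at *
    generalize frac k t (α + 1) (α * p + 2) = v at *
    generalize frac k (t ^ p) (α * p + 1) (α * p + 2) = w at *
    generalize algebraMap (R k) (Rxy k) (Xx k) = x at *
    generalize algebraMap (R k) (Rxy k) (Xy k) = y at *
    linear_combination -(x ^ (d + 1) * y) * h1 + x ^ (c + 1) * h2 - h3 -
      y ^ (α * p + 2) * u * e1 + y ^ (α * p + 2) * v * e2
  have hx (f : R k) (n : ℕ) :
      coeff (p • Finsupp.single (1 : Fin 2) α) (f * Xx k ^ (n + 1)) = 0 := by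
    rw [pow_succ, ← mul_assoc, coeff_mul_X', if_neg (by simp)]
  rw [coeff_sub, coeff_add, coeff_neg, mul_comm (Xx k ^ _), hx, hx, coeff_smul_pow_char] at h0
  simp at h0
  exact hty h0.1

end
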